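/- Let ψ be the alternating 4-tensor on ℝ^7 whose only nonzero components (up to permutation sign) are ψ_{4567} = ψ_{2367} = ψ_{2345} = ψ_{1357} = 1 and ψ_{1346} = ψ_{1256} = ψ_{1247} = −1. Then for all indices i, a: Σ_{j,k,l} ψ_{ijkl} ψ_{ajkl} = 24 δ_{ia}. -/

import Mathlib

/-- Kronecker delta on `Fin 7`. -/
def kdelta (i j : Fin 7) : ℝ := if i = j then 1 else 0

/-- The fully antisymmetric tensor with `eps3 a b c a b c = 1`
(a 3×3 determinant of Kronecker deltas). -/
def eps3 (a b c i j k : Fin 7) : ℝ :=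
  kdelta i a * (kdelta j b * kdelta k c - kdelta j c * kdelta k b)
  - kdelta i b * (kdelta j a * kdelta k c - kdelta j c * kdelta k a)
  + kdelta i c * (kdelta j a * kdelta k b - kdelta j b * kdelta k a)

/-- The fully antisymmetric tensor with `eps4 a b c d a b c d = 1`
(a 4×4 determinant of Kronecker deltas). -/
def eps4 (a b c d i j k l : Fin 7) : ℝ :=
  kdelta i a * eps3 b c d j k l - kdelta i b * eps3 a c d j k l
  + kdelta i c * eps3 a b d j k l - kdelta i d * eps3 a b c j k l

/-- The standard G₂ 3-form `φ` on `ℝ⁷`, as a fully antisymmetric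
map `Fin 7 → Fin 7 → Fin 7 → ℝ` whose nonzero components (up to permutation sign)
are `φ_{123} = φ_{145} = φ_{167} = φ_{246} = 1`, `φ_{257} = φ_{347} = φ_{356} = -1`
(indices 1,…,7 written as 0,…,6). -/
def phiG2 (i j k : Fin 7) : ℝ :=
  eps3 0 1 2 i j k + eps3 0 3 4 i j k + eps3 0 5 6 i j k + eps3 1 3 5 i j k
  - eps3 1 4 6 i j k - eps3 2 3 6 i j k - eps3 2 4 5 i j k

/-- The standard G₂ 4-form `ψ = ∗φ` on `ℝ⁷`, as a fully antisymmetric map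
on `Fin 7` whose nonzero components (up to permutation sign) are
`ψ_{4567} = ψ_{2367} = ψ_{2345} = ψ_{1357} = 1`, `ψ_{1346} = ψ_{1256} = ψ_{1247} = -1`
(indices 1,…,7 written as 0,…,6). -/
def psiG2 (i j k l : Fin 7) : ℝ :=
  eps4 3 4 5 6 i j k l + eps4 1 2 5 6 i j k l + eps4 1 2 3 4 i j k l + eps4 0 2 4 6 i j k l
  - eps4 0 2 3 5 i j k l - eps4 0 1 4 5 i j k l - eps4 0 1 3 6 i j k l

/-- Integer two-index antisymmetric symbol, evaluated by case distinction. -/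
def e2Z (b c j k : Fin 7) : ℤ :=
  if j = b then (if k = c then 1 else 0) else if j = c then (if k = b then -1 else 0) else 0

/-- Integer version of `eps3` (for distinct upper indices). -/
def e3Z (a b c i j k : Fin 7) : ℤ :=
  if i = a then e2Z b c j k else if i = b then -e2Z a c j k
  else if i = c then e2Z a b j k else 0

/-- Integer version of `eps4` (for distinct upper indices). -/
def e4Z (a b c d i j k l : Fin 7) : ℤ :=
  if i = a then e3Z b c d j k l else if i = b then -e3Z a c d j k l
  else if i = c then e3Z a b d j k l else if i = d then -e3Z a b c j k l else 0

/-- Integer version of `psiG2`. -/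
def psiZ (i j k l : Fin 7) : ℤ :=
  e4Z 3 4 5 6 i j k l + e4Z 1 2 5 6 i j k l + e4Z 1 2 3 4 i j k l + e4Z 0 2 4 6 i j k l
  - e4Z 0 2 3 5 i j k l - e4Z 0 1 4 5 i j k l - e4Z 0 1 3 6 i j k l

/-- Product that only looks at the second factor if the first one is nonzero. -/
def lazyMul (x : ℤ) (y : ℤ) : ℤ := if x = 0 then 0 else x * y

theorem lazyMul_eq (x y : ℤ) : lazyMul x y = x * y := by
  unfold lazyMul; split_ifs with h <;> simp [h]

theorem e2Z_cast (b c j k : Fin 7) (h : b ≠ c) :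
    kdelta j b * kdelta k c - kdelta j c * kdelta k b = (e2Z b c j k : ℝ) := by
  unfold kdelta e2Z
  by_cases h1 : j = b
  · subst h1; simp [h]
  · by_cases h2 : j = c
    · subst h2
      by_cases h3 : k = b <;> simp [h1, h3]
    · simp [h1, h2]

theorem eps3_cast (a b c i j k : Fin 7) (hab : a ≠ b) (hac : a ≠ c) (hbc : b ≠ c) :
    eps3 a b c i j k = (e3Z a b c i j k : ℝ) := by
  unfold eps3 e3Z
  rw [e2Z_cast b c j k hbc, e2Z_cast a c j k hac, e2Z_cast a b j k hab]
  unfold kdelta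
  by_cases h1 : i = a
  · subst h1; simp [hab, hac]
  · by_cases h2 : i = b
    · subst h2; simp [h1, hbc]
    · by_cases h3 : i = c
      · subst h3; simp [h1, h2]
      · simp [h1, h2, h3]

theorem eps4_cast (a b c d i j k l : Fin 7) (hab : a ≠ b) (hac : a ≠ c) (had : a ≠ d)
    (hbc : b ≠ c) (hbd : b ≠ d) (hcd : c ≠ d) :
    eps4 a b c d i j k l = (e4Z a b c d i j k l : ℝ) := by
  unfold eps4 e4Z
  rw [eps3_cast b c d j k l hbc hbd hcd, eps3_cast a c d j k l hac had hcd,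
    eps3_cast a b d j k l hab had hbd, eps3_cast a b c j k l hab hac hbc]
  unfold kdelta
  by_cases h1 : i = a
  · subst h1; simp [hab, hac, had]
  · by_cases h2 : i = b
    · subst h2; simp [h1, hbc, hbd]
    · by_cases h3 : i = c
      · subst h3; simp [h1, h2, hcd]
      · by_cases h4 : i = d
        · subst h4; simp [h1, h2, h3]
        · simp [h1, h2, h3, h4]

theorem psi_cast (i j k l : Fin 7) : psiG2 i j k l = (psiZ i j k l : ℝ) := by
  unfold psiG2 psiZ
  push_cast
  repeat rw [eps4_cast _ _ _ _ i j k l (by decide) (by decide) (by decide) (by decide)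
    (by decide) (by decide)]

theorem psiZ_contraction : ∀ i a : Fin 7,
    ∑ j : Fin 7, ∑ k : Fin 7, ∑ l : Fin 7, lazyMul (psiZ i j k l) (psiZ a j k l) =
      if i = a then 24 else 0 := by
  decide +kernel

theorem psi_contraction_three (i a : Fin 7) :
    ∑ j : Fin 7, ∑ k : Fin 7, ∑ l : Fin 7, psiG2 i j k l * psiG2 a j k l =
      24 * kdelta i a := by
  have h := congrArg (Int.cast : ℤ → ℝ) (psiZ_contraction i a)
  simp only [lazyMul_eq] at h
  push_cast at h
  simp only [psi_cast, h, kdelta, mul_ite, mul_one, mul_zero]
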